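/- arXiv:1904.02219 — 6 statements merged into one kernel-verified Lean document; each statement's English description precedes it below -/
import Mathlib

section
/- Fix λ > 0 and data consisting, for each stratum h = 1,…,H and cluster i = 1,…,n_h, of a covariate x_hi ∈ ℝ^{k+1}, a weight w_hi ∈ ℝ, a size m_hi ∈ ℝ and a count vector ŷ_hi ∈ ℝ^{d+1}. Then the objective function D(β) = Σ_{h=1}^H Σ_{i=1}^{n_h} w_hi · (m_hi π_hi(β) − ((1+λ)/λ) ŷ_hi)ᵀ · π_hi(β)^{∘λ}, where π_hi(β) = π(β, x_hi) and π^{∘λ} denotes the entrywise λ-th power, is differentiable in β ∈ ℝ^{d(k+1)} and its gradient satisfies ∇D(β) = −(λ+1) · Σ_{h=1}^H Σ_{i=1}^{n_h} [ w_hi Δ*(π_hi(β)) diag^{λ−1}(π_hi(β)) (ŷ_hi − m_hi π_hi(β)) ] ⊗ x_hi. Consequently, any minimizer of D (the minimum quasi weighted DPD estimate) solves the estimating equations u_λ(β) = Σ_{h,i} [ w_hi Δ*(π_hi(β)) diag^{λ−1}(π_hi(β)) (ŷ_hi − m_hi π_hi(β)) ] ⊗ x_hi = 0. -/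
open Real Matrix

noncomputable def plr (d k : ℕ) (β : Fin d → Fin (k + 1) → ℝ) (x : Fin (k + 1) → ℝ) :
    Fin (d + 1) → ℝ := fun r =>
  if h : (r : ℕ) < d then
    Real.exp (∑ u, x u * β ⟨r, h⟩ u) / (1 + ∑ l, Real.exp (∑ u, x u * β l u))
  else 1 / (1 + ∑ l, Real.exp (∑ u, x u * β l u))

noncomputable def DeltaMat {n : ℕ} (p : Fin n → ℝ) : Matrix (Fin n) (Fin n) ℝ :=
  Matrix.diagonal p - Matrix.of fun i j => p i * p j

noncomputable def DeltaStar (d : ℕ) (p : Fin (d + 1) → ℝ) : Matrix (Fin d) (Fin (d + 1)) ℝ :=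
  Matrix.of fun i j => DeltaMat p i.castSucc j

/-- `diag^{λ−1}(p)`: diagonal matrix with entries `p_l^{λ−1}` (real power). -/
noncomputable def diagPow (lam : ℝ) {n : ℕ} (p : Fin n → ℝ) : Matrix (Fin n) (Fin n) ℝ :=
  Matrix.diagonal fun l => p l ^ (lam - 1)

/-- The summand `[w Δ*(p) diag^{λ−1}(p) (y − m p)] ⊗ x ∈ ℝ^{d(k+1)}` of the
minimum quasi weighted DPD estimating function. -/
noncomputable def uSummand (lam : ℝ) (d k : ℕ) (w m : ℝ) (p : Fin (d + 1) → ℝ)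
    (y : Fin (d + 1) → ℝ) (x : Fin (k + 1) → ℝ) : Fin d → Fin (k + 1) → ℝ :=
  fun v u => w * ((DeltaStar d p * diagPow lam p).mulVec (y - m • p)) v * x u


lemma plr_pos (d k : ℕ) (β : Fin d → Fin (k + 1) → ℝ) (x : Fin (k + 1) → ℝ) (l : Fin (d + 1)) :
    0 < plr d k β x l := by
  unfold plr
  split_ifs <;> positivity

lemma plr_differentiable (d k : ℕ) (x : Fin (k + 1) → ℝ) (l : Fin (d + 1)) :
    Differentiable ℝ (fun β => plr d k β x l) := by
  intro β
  have hpos : (1 + ∑ l, Real.exp (∑ u, x u * β l u)) ≠ 0 := by positivity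
  have hd : DifferentiableAt ℝ (fun β : Fin d → Fin (k + 1) → ℝ =>
      (1 + ∑ l, Real.exp (∑ u, x u * β l u))⁻¹) β :=
    DifferentiableAt.fun_inv (by fun_prop) hpos
  unfold plr
  simp only [div_eq_mul_inv]
  split_ifs
  · exact DifferentiableAt.fun_mul (by fun_prop) hd
  · exact DifferentiableAt.fun_mul (by fun_prop) hd

lemma eta_hasDerivAt (d k : ℕ) (x : Fin (k + 1) → ℝ) (β : Fin d → Fin (k + 1) → ℝ)
    (v : Fin d) (u : Fin (k + 1)) (r : Fin d) :
    HasDerivAt (fun t : ℝ => Real.exp (∑ j, x j * (β + t • (Pi.single v (Pi.single u 1) :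
      Fin d → Fin (k + 1) → ℝ)) r j))
      (Real.exp (∑ j, x j * β r j) * (if r = v then x u else 0)) 0 := by
  have h : ∀ t : ℝ, ∑ j, x j * (β + t • (Pi.single v (Pi.single u 1) :
      Fin d → Fin (k + 1) → ℝ)) r j = ∑ j, x j * β r j + t * (if r = v then x u else 0) := by
    intro t
    by_cases hr : r = v
    · subst hr
      simp [mul_add, Finset.sum_add_distrib, Pi.single_apply, mul_comm]
    · simp [hr]
  simp only [h]
  have := (((hasDerivAt_id (0 : ℝ)).mul_const (if r = v then x u else 0)).const_add
    (∑ j, x j * β r j)).exp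
  simpa using this

lemma plr_line (d k : ℕ) (x : Fin (k + 1) → ℝ) (β : Fin d → Fin (k + 1) → ℝ)
    (v : Fin d) (u : Fin (k + 1)) (l : Fin (d + 1)) :
    HasDerivAt (fun t : ℝ => plr d k (β + t • (Pi.single v (Pi.single u 1) :
      Fin d → Fin (k + 1) → ℝ)) x l)
      (DeltaStar d (plr d k β x) v l * x u) 0 := by
  have hpos : (1 + ∑ l, Real.exp (∑ u, x u * β l u)) ≠ 0 := by positivity
  have hden := (HasDerivAt.fun_sum (u := Finset.univ)
    (fun r _ => eta_hasDerivAt d k x β v u r)).const_add 1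
  simp only [mul_ite, mul_zero, Finset.sum_ite_eq', Finset.mem_univ, if_true] at hden
  have hv : plr d k β x v.castSucc = Real.exp (∑ u, x u * β v u) /
      (1 + ∑ l, Real.exp (∑ u, x u * β l u)) := by
    simp [plr]
  simp only [DeltaStar, DeltaMat, Matrix.of_apply, Matrix.sub_apply, hv]
  by_cases hl : (l : ℕ) < d
  · obtain ⟨r, rfl⟩ : ∃ r : Fin d, l = r.castSucc := ⟨⟨l, hl⟩, rfl⟩
    have hr : ∀ β, plr d k β x r.castSucc = Real.exp (∑ u, x u * β r u) /
        (1 + ∑ l, Real.exp (∑ u, x u * β l u)) := by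
      intro β; simp [plr]
    simp only [hr]
    have := (eta_hasDerivAt d k x β v u r).fun_div hden (by simpa using hpos)
    refine this.congr_deriv ?_
    symm
    simp only [zero_smul, add_zero]
    by_cases hrv : r = v
    · subst hrv
      simp only [Matrix.diagonal_apply_eq, hv, if_true]
      field_simp
    · rw [Matrix.diagonal_apply_ne _ (by simpa using fun h => hrv h.symm)]
      simp only [hrv, if_false]
      field_simp
      ring
  · have hr : ∀ β, plr d k β x l = 1 / (1 + ∑ l, Real.exp (∑ u, x u * β l u)) := by
      intro β; simp [plr, hl]
    simp only [hr]
    have := (hasDerivAt_const (0 : ℝ) (1 : ℝ)).fun_div hden (by simpa using hpos)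
    refine this.congr_deriv ?_
    symm
    simp only [zero_smul, add_zero]
    rw [Matrix.diagonal_apply_ne _ (by rintro rfl; exact hl v.2)]
    field_simp
    ring

lemma term_line (lam : ℝ) (hlam : 0 < lam) (m y c p' : ℝ) (p : ℝ → ℝ)
    (hc : c = (1 + lam) / lam) (hp : HasDerivAt p p' 0) (h0 : 0 < p 0) :
    HasDerivAt (fun t => (m * p t - c * y) * p t ^ lam)
      (-(lam + 1) * (p' * (p 0 ^ (lam - 1) * (y - m * p 0)))) 0 := by
  have h := ((hp.const_mul m).sub_const (c * y)).fun_mul (hp.rpow_const (p := lam) (Or.inl h0.ne'))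
  refine h.congr_deriv ?_
  symm
  have e : p 0 ^ lam = p 0 ^ (lam - 1) * p 0 := by
    rw [Real.rpow_sub_one h0.ne']; field_simp
  rw [e, hc]
  field_simp
  ring

/-- The quasi weighted DPD objective `D(β)` is differentiable with gradient
`−(λ+1) u_λ(β)`, where `u_λ(β) = Σ_{h,i} [w_hi Δ*(π_hi(β)) diag^{λ−1}(π_hi(β))
(ŷ_hi − m_hi π_hi(β))] ⊗ x_hi`; consequently any minimizer of `D` (the minimum quasi
weighted DPD estimate) solves the estimating equations `u_λ(β) = 0`. -/
theorem mdpde_estimating_equations (d k H : ℕ) (lam : ℝ) (hlam : 0 < lam)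
    (nh : Fin H → ℕ)
    (x : ∀ h : Fin H, Fin (nh h) → Fin (k + 1) → ℝ)
    (w m : ∀ h : Fin H, Fin (nh h) → ℝ)
    (yhat : ∀ h : Fin H, Fin (nh h) → Fin (d + 1) → ℝ) :
    letI D : (Fin d → Fin (k + 1) → ℝ) → ℝ := fun β =>
      ∑ h, ∑ i, w h i *
        ∑ l, (m h i * plr d k β (x h i) l - ((1 + lam) / lam) * yhat h i l) *
          plr d k β (x h i) l ^ lam
    letI ulam : (Fin d → Fin (k + 1) → ℝ) → Fin d → Fin (k + 1) → ℝ := fun β v u =>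
      ∑ h, ∑ i, uSummand lam d k (w h i) (m h i) (plr d k β (x h i)) (yhat h i) (x h i) v u
    Differentiable ℝ D ∧
    (∀ (β : Fin d → Fin (k + 1) → ℝ) (v : Fin d) (u : Fin (k + 1)),
      fderiv ℝ D β (Pi.single v (Pi.single u 1)) = -(lam + 1) * ulam β v u) ∧
    (∀ β₀ : Fin d → Fin (k + 1) → ℝ, IsMinOn D Set.univ β₀ →
      ∀ v u, ulam β₀ v u = 0) := by
  set D : (Fin d → Fin (k + 1) → ℝ) → ℝ := fun β =>
      ∑ h, ∑ i, w h i *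
        ∑ l, (m h i * plr d k β (x h i) l - ((1 + lam) / lam) * yhat h i l) *
          plr d k β (x h i) l ^ lam with hDdef
  set ulam : (Fin d → Fin (k + 1) → ℝ) → Fin d → Fin (k + 1) → ℝ := fun β v u =>
      ∑ h, ∑ i, uSummand lam d k (w h i) (m h i) (plr d k β (x h i)) (yhat h i) (x h i) v u
    with hulam
  have hD : Differentiable ℝ D := by
    refine Differentiable.fun_sum fun h _ => Differentiable.fun_sum fun i _ =>
      Differentiable.const_mul (Differentiable.fun_sum fun l _ => ?_) _
    have hp := plr_differentiable d k (x h i) l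
    exact ((hp.const_mul _).sub_const _).fun_mul
      (hp.rpow_const fun β => Or.inl (plr_pos d k β (x h i) l).ne')
  have hg : ∀ (β : Fin d → Fin (k + 1) → ℝ) (v : Fin d) (u : Fin (k + 1)),
      fderiv ℝ D β (Pi.single v (Pi.single u 1)) = -(lam + 1) * ulam β v u := by
    intro β v u
    rw [← (hD β).lineDeriv_eq_fderiv]
    refine HasLineDerivAt.lineDeriv ?_
    have key : HasDerivAt (fun t : ℝ => D (β + t • (Pi.single v (Pi.single u 1) :
        Fin d → Fin (k + 1) → ℝ))) _ 0 :=
      HasDerivAt.fun_sum fun h _ => HasDerivAt.fun_sum fun i _ =>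
        HasDerivAt.const_mul (w h i) (HasDerivAt.fun_sum fun l _ =>
          term_line lam hlam (m h i) (yhat h i l) _ _ _ rfl
            (plr_line d k (x h i) β v u l) (plr_pos _ _ _ _ _))
    unfold HasLineDerivAt
    refine key.congr_deriv ?_
    symm
    simp only [ulam, Finset.mul_sum]
    refine Finset.sum_congr rfl fun h _ => Finset.sum_congr rfl fun i _ => ?_
    simp only [uSummand, diagPow, Matrix.mulVec, dotProduct, Matrix.mul_diagonal,
      Finset.mul_sum, Finset.sum_mul, zero_smul, add_zero, Pi.sub_apply, Pi.smul_apply,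
      smul_eq_mul]
    refine Finset.sum_congr rfl fun l _ => ?_
    ring
  refine ⟨hD, hg, fun β₀ hmin v u => ?_⟩
  have hz : fderiv ℝ D β₀ = 0 := (hmin.isLocalMin Filter.univ_mem).fderiv_eq_zero
  have := hg β₀ v u
  rw [hz] at this
  have hne : -(lam + 1) ≠ 0 := by linarith
  exact (mul_eq_zero.mp this.symm).resolve_left hne
end

section
/- Fix λ > 0, β ∈ ℝ^{d(k+1)}, a common cluster size m̄ > 0, an overdispersion parameter ν ∈ ℝ, and for each stratum h = 1,…,H and cluster i = 1,…,n_h a covariate x_hi ∈ ℝ^{k+1} and weight w_hi ∈ ℝ. Suppose each Ŷ_hi is a square-integrable random vector in ℝ^{d+1} with E[Ŷ_hi] = m̄ π_hi(β) and covariance E[(Ŷ_hi − m̄ π_hi(β))(Ŷ_hi − m̄ π_hi(β))ᵀ] = ν m̄ Δ(π_hi(β)), where π_hi(β) = π(β, x_hi). Let n = Σ_h n_h, Ω̂_{n,λ}(β) = (1/n) Σ_{h,i} U_λ(β, x_hi) U_λ(β, x_hi)ᵀ with U_λ(β,x_hi) = [w_hi Δ*(π_hi(β)) diag^{λ−1}(π_hi(β))(Ŷ_hi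 − m̄ π_hi(β))] ⊗ x_hi, and let Ω_{n,λ}(β) = (1/n) Σ_{h,i} m̄ w_hi² [Δ*(π_hi(β)) diag^{λ−1}(π_hi(β)) Δ(π_hi(β)) diag^{λ−1}(π_hi(β)) Δ*(π_hi(β))ᵀ] ⊗ x_hi x_hiᵀ be the multinomial-scheme version. Then E[Ω̂_{n,λ}(β)] = ν · Ω_{n,λ}(β), and if the d(k+1) × d(k+1) matrix Ω_{n,λ}(β) is invertible then (1/(d(k+1))) · trace( Ω_{n,λ}(β)^{−1} · E[Ω̂_{n,λ}(β)] ) = ν. -/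
open Real Matrix MeasureTheory

/-- `U_λ(β,x)` indexed by pairs `(v,u) ∈ Fin d × Fin (k+1)`. -/
noncomputable def uSummandP (lam : ℝ) (d k : ℕ) (w m : ℝ) (p : Fin (d + 1) → ℝ)
    (y : Fin (d + 1) → ℝ) (x : Fin (k + 1) → ℝ) : Fin d × Fin (k + 1) → ℝ :=
  fun a => w * ((DeltaStar d p * diagPow lam p).mulVec (y - m • p)) a.1 * x a.2

/-- The multinomial-scheme matrix
`Ω_{n,λ}(β) = (1/n) Σ_{h,i} m̄ w_hi² [Δ* diag^{λ−1} Δ diag^{λ−1} Δ*ᵀ](π_hi(β)) ⊗ x_hi x_hiᵀ`. -/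
noncomputable def OmegaMult (d k H : ℕ) (lam : ℝ) (β : Fin d → Fin (k + 1) → ℝ)
    (mbar : ℝ) (nh : Fin H → ℕ) (x : ∀ h : Fin H, Fin (nh h) → Fin (k + 1) → ℝ)
    (w : ∀ h : Fin H, Fin (nh h) → ℝ) :
    Matrix (Fin d × Fin (k + 1)) (Fin d × Fin (k + 1)) ℝ :=
  (((∑ h, nh h : ℕ) : ℝ))⁻¹ •
    ∑ h, ∑ i,
      Matrix.of fun a b =>
        mbar * w h i ^ 2 *
          (DeltaStar d (plr d k β (x h i)) * diagPow lam (plr d k β (x h i)) *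
            DeltaMat (plr d k β (x h i)) * diagPow lam (plr d k β (x h i)) *
            (DeltaStar d (plr d k β (x h i)))ᵀ) a.1 b.1 *
          (x h i a.2 * x h i b.2)

/-- Componentwise expectation of `Ω̂_{n,λ}(β) = (1/n) Σ_{h,i} U_λ(β,x_hi) U_λ(β,x_hi)ᵀ`. -/
noncomputable def EOmegaHat (d k H : ℕ) (lam : ℝ) (β : Fin d → Fin (k + 1) → ℝ)
    (mbar : ℝ) (nh : Fin H → ℕ) (x : ∀ h : Fin H, Fin (nh h) → Fin (k + 1) → ℝ)
    (w : ∀ h : Fin H, Fin (nh h) → ℝ)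
    {Ω : Type*} [MeasurableSpace Ω] (μ : Measure Ω)
    (Y : ∀ h : Fin H, Fin (nh h) → Ω → Fin (d + 1) → ℝ) :
    Matrix (Fin d × Fin (k + 1)) (Fin d × Fin (k + 1)) ℝ :=
  Matrix.of fun a b =>
    ∫ ω, (((∑ h, nh h : ℕ) : ℝ))⁻¹ *
      ∑ h, ∑ i,
        uSummandP lam d k (w h i) mbar (plr d k β (x h i)) (Y h i ω) (x h i) a *
        uSummandP lam d k (w h i) mbar (plr d k β (x h i)) (Y h i ω) (x h i) b ∂μ

theorem uu_expand (lam : ℝ) (d k : ℕ) (w m : ℝ) (p y : Fin (d + 1) → ℝ)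
    (x : Fin (k + 1) → ℝ) (a b : Fin d × Fin (k + 1)) :
    uSummandP lam d k w m p y x a * uSummandP lam d k w m p y x b =
      ∑ l, ∑ l', (w ^ 2 * (x a.2 * x b.2) * ((DeltaStar d p * diagPow lam p) a.1 l *
        (DeltaStar d p * diagPow lam p) b.1 l')) * ((y l - m * p l) * (y l' - m * p l')) := by
  unfold uSummandP
  generalize DeltaStar d p * diagPow lam p = A
  have : w * (A.mulVec (y - m • p)) a.1 * x a.2 * (w * (A.mulVec (y - m • p)) b.1 * x b.2)
      = (w ^ 2 * (x a.2 * x b.2)) *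
        ((A.mulVec (y - m • p)) a.1 * (A.mulVec (y - m • p)) b.1) := by ring
  rw [this]
  simp only [Matrix.mulVec, dotProduct, Pi.sub_apply, Pi.smul_apply, smul_eq_mul]
  rw [Finset.sum_mul_sum]
  simp only [Finset.mul_sum]
  refine Finset.sum_congr rfl fun l _ => Finset.sum_congr rfl fun l' _ => ?_
  ring

theorem quad_expand (lam : ℝ) (d : ℕ) (p : Fin (d + 1) → ℝ) (a b : Fin d) :
    (DeltaStar d p * diagPow lam p * DeltaMat p * diagPow lam p * (DeltaStar d p)ᵀ) a b =
      ∑ l, ∑ l', ((DeltaStar d p * diagPow lam p) a l *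
        (DeltaStar d p * diagPow lam p) b l') * DeltaMat p l l' := by
  have h : DeltaStar d p * diagPow lam p * DeltaMat p * diagPow lam p * (DeltaStar d p)ᵀ
      = (DeltaStar d p * diagPow lam p) * DeltaMat p * (DeltaStar d p * diagPow lam p)ᵀ := by
    rw [Matrix.transpose_mul]
    have : (diagPow lam p)ᵀ = diagPow lam p := by simp [diagPow]
    rw [this]
    simp only [Matrix.mul_assoc]
  rw [h]
  generalize DeltaStar d p * diagPow lam p = A
  rw [Matrix.mul_apply, Finset.sum_comm]
  refine Finset.sum_congr rfl fun l _ => ?_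
  rw [Matrix.mul_apply, Finset.sum_mul]
  refine Finset.sum_congr rfl fun l' _ => ?_
  rw [Matrix.transpose_apply]
  ring

/-- Under the overdispersed multinomial moment conditions
`E[Ŷ_hi] = m̄ π_hi(β)` and `Cov(Ŷ_hi) = ν m̄ Δ(π_hi(β))`, one has
`E[Ω̂_{n,λ}(β)] = ν Ω_{n,λ}(β)`, and if `Ω_{n,λ}(β)` is invertible then
`(1/(d(k+1))) trace(Ω_{n,λ}(β)⁻¹ E[Ω̂_{n,λ}(β)]) = ν` (the population identity behind
the estimating-equation overdispersion estimator). -/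
theorem overdispersion_estimating_equation_identity (d k H : ℕ) (hd : 0 < d)
    (lam : ℝ) (hlam : 0 < lam) (β : Fin d → Fin (k + 1) → ℝ)
    (mbar ν : ℝ) (hmbar : 0 < mbar) (nh : Fin H → ℕ)
    (x : ∀ h : Fin H, Fin (nh h) → Fin (k + 1) → ℝ)
    (w : ∀ h : Fin H, Fin (nh h) → ℝ)
    {Ω : Type*} [MeasurableSpace Ω] (μ : Measure Ω) [IsProbabilityMeasure μ]
    (Y : ∀ h : Fin H, Fin (nh h) → Ω → Fin (d + 1) → ℝ)
    (hint : ∀ h i l, Integrable (fun ω => Y h i ω l) μ)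
    (hint2 : ∀ h i l l', Integrable (fun ω =>
        (Y h i ω l - mbar * plr d k β (x h i) l) *
        (Y h i ω l' - mbar * plr d k β (x h i) l')) μ)
    (hmean : ∀ h i l, ∫ ω, Y h i ω l ∂μ = mbar * plr d k β (x h i) l)
    (hcov : ∀ h i l l', ∫ ω,
        (Y h i ω l - mbar * plr d k β (x h i) l) *
        (Y h i ω l' - mbar * plr d k β (x h i) l') ∂μ =
        ν * mbar * DeltaMat (plr d k β (x h i)) l l') :
    (∀ a b, EOmegaHat d k H lam β mbar nh x w μ Y a b =
      ν * OmegaMult d k H lam β mbar nh x w a b) ∧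
    (IsUnit (OmegaMult d k H lam β mbar nh x w).det →
      ((d * (k + 1) : ℕ) : ℝ)⁻¹ *
        Matrix.trace ((OmegaMult d k H lam β mbar nh x w)⁻¹ *
          EOmegaHat d k H lam β mbar nh x w μ Y) = ν) := by
  have key : ∀ a b, EOmegaHat d k H lam β mbar nh x w μ Y a b =
      ν * OmegaMult d k H lam β mbar nh x w a b := by
    intro a b
    simp only [EOmegaHat, OmegaMult, Matrix.of_apply, Matrix.smul_apply, Matrix.sum_apply,
      smul_eq_mul, uu_expand, quad_expand]
    rw [integral_const_mul, mul_left_comm]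
    congr 1
    have hI : ∀ h i l l' (c : ℝ), Integrable (fun ω => c *
        ((Y h i ω l - mbar * plr d k β (x h i) l) *
        (Y h i ω l' - mbar * plr d k β (x h i) l'))) μ :=
      fun h i l l' c => (hint2 h i l l').const_mul c
    rw [integral_finsetSum _ fun h _ => integrable_finsetSum _ fun i _ =>
      integrable_finsetSum _ fun l _ => integrable_finsetSum _ fun l' _ => hI h i l l' _,
      Finset.mul_sum]
    refine Finset.sum_congr rfl fun h _ => ?_
    rw [integral_finsetSum _ fun i _ =>
      integrable_finsetSum _ fun l _ => integrable_finsetSum _ fun l' _ => hI h i l l' _,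
      Finset.mul_sum]
    refine Finset.sum_congr rfl fun i _ => ?_
    rw [integral_finsetSum _ fun l _ => integrable_finsetSum _ fun l' _ => hI h i l l' _,
      Finset.mul_sum, Finset.sum_mul, Finset.mul_sum]
    refine Finset.sum_congr rfl fun l _ => ?_
    rw [integral_finsetSum _ fun l' _ => hI h i l l' _,
      Finset.mul_sum, Finset.sum_mul, Finset.mul_sum]
    refine Finset.sum_congr rfl fun l' _ => ?_
    rw [integral_const_mul, hcov]
    ring
  refine ⟨key, fun hu => ?_⟩
  have hE : EOmegaHat d k H lam β mbar nh x w μ Y =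
      ν • OmegaMult d k H lam β mbar nh x w := by
    ext a b
    rw [key, Matrix.smul_apply, smul_eq_mul]
  rw [hE, Matrix.mul_smul, Matrix.nonsing_inv_mul _ hu, Matrix.trace_smul, Matrix.trace_one]
  have hne : ((d * (k + 1) : ℕ) : ℝ) ≠ 0 := by positivity
  simp only [Fintype.card_prod, Fintype.card_fin, smul_eq_mul]
  field_simp
end

section
/- Let π ∈ ℝ^{d+1} be a vector with all entries positive summing to 1. Then Δ*(π) · diag(π)^{−1} · Δ*(π)ᵀ = Δ(π*) = diag(π*) − π* π*ᵀ, where Δ*(π) is the d × (d+1) matrix of the first d rows of Δ(π) = diag(π) − π πᵀ and π* ∈ ℝ^d is the vector of the first d coordinates of π. (This identity shows that the λ > 0 formula for the matrix Ψ_{hi,λ} reduces, at λ = 0, to the Fisher information form w m Δ(π*) ⊗ x xᵀ given in the paper.) -/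
open Matrix

/-- If `π` has positive entries summing to 1, then
`Δ*(π) diag(π)⁻¹ Δ*(π)ᵀ = Δ(π*) = diag(π*) − π* π*ᵀ`, where `π*` is the vector of the
first `d` coordinates of `π`. -/
theorem deltaStar_diag_inv_deltaStar_transpose (d : ℕ) (p : Fin (d + 1) → ℝ)
    (hpos : ∀ l, 0 < p l) (hsum : ∑ l, p l = 1) :
    DeltaStar d p * Matrix.diagonal (fun l => (p l)⁻¹) * (DeltaStar d p)ᵀ =
      DeltaMat fun i : Fin d => p i.castSucc := by
  ext i j
  have key : ∀ l, DeltaStar d p i l * (p l)⁻¹ * DeltaStar d p j l =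
      (if i.castSucc = l then DeltaStar d p j l else 0) -
      p i.castSucc * ((if j.castSucc = l then p j.castSucc else 0) - p j.castSucc * p l) := by
    intro l
    have h := (hpos l).ne'
    have h1 : DeltaStar d p i l * (p l)⁻¹ = (if i.castSucc = l then 1 else 0) - p i.castSucc := by
      simp only [DeltaStar, DeltaMat, Matrix.of_apply, Matrix.sub_apply, Matrix.diagonal_apply]
      split_ifs with hl
      · subst hl
        field_simp
      · field_simp
        ring
    have h2 : DeltaStar d p j l =
        (if j.castSucc = l then p j.castSucc else 0) - p j.castSucc * p l := by
      simp only [DeltaStar, DeltaMat, Matrix.of_apply, Matrix.sub_apply, Matrix.diagonal_apply]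
    rw [h1, ← h2]
    split_ifs <;> ring
  rw [Matrix.mul_apply]
  simp only [Matrix.mul_diagonal, Matrix.transpose_apply, key]
  rw [Finset.sum_sub_distrib, ← Finset.mul_sum, Finset.sum_sub_distrib, ← Finset.mul_sum, hsum,
    Finset.sum_ite_eq, Finset.sum_ite_eq]
  simp only [Finset.mem_univ, if_true, DeltaStar, DeltaMat, Matrix.of_apply, Matrix.sub_apply,
    Matrix.diagonal_apply, Fin.castSucc_inj]
  by_cases hij : i = j
  · subst hij
    simp
  · simp [hij, Ne.symm hij, mul_comm]
end

section
/- Fix λ > 0 and d ∈ ℕ. Let p, q ∈ ℝ^{d+1} be vectors with nonnegative entries each summing to 1, with all entries of p positive. Then the density power divergence d_λ(q, p) = Σ_{l=1}^{d+1} [ p_l^{λ+1} − ((λ+1)/λ) p_l^λ q_l + (1/λ) q_l^{λ+1} ] satisfies d_λ(q, p) ≥ 0, with equality if and only if p = q. -/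
theorem dpd_term_pos (lam a b : ℝ) (hlam : 0 < lam) (ha : 0 < a) (hb : 0 ≤ b) (hab : a ≠ b) :
    0 < a ^ (lam + 1) - ((lam + 1) / lam) * a ^ lam * b + (1 / lam) * b ^ (lam + 1) := by
  have ht : 0 ≤ b / a := by positivity
  have h1 : b / a - 1 ≠ 0 := by
    intro h
    have h2 : b / a = 1 := by linarith
    rw [div_eq_one_iff_eq ha.ne'] at h2
    exact hab h2.symm
  have hB := one_add_mul_self_lt_rpow_one_add (s := b / a - 1) (by linarith) h1
    (p := lam + 1) (by linarith)
  rw [add_sub_cancel] at hB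
  have hbt : b = a * (b / a) := by field_simp
  generalize b / a = t at *
  subst hbt
  rw [Real.mul_rpow ha.le ht, Real.rpow_add_one ha.ne']
  have hA : 0 < a ^ lam := Real.rpow_pos_of_pos ha _
  have key : a ^ lam * a - ((lam + 1) / lam) * a ^ lam * (a * t)
      + (1 / lam) * (a ^ lam * a * t ^ (lam + 1))
      = a ^ lam * a / lam * (t ^ (lam + 1) - (1 + (lam + 1) * (t - 1))) := by
    field_simp
    ring
  rw [key]
  exact mul_pos (by positivity) (by linarith)

theorem dpd_term_self (lam a : ℝ) (hlam : 0 < lam) (ha : 0 < a) :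
    a ^ (lam + 1) - ((lam + 1) / lam) * a ^ lam * a + (1 / lam) * a ^ (lam + 1) = 0 := by
  rw [Real.rpow_add_one ha.ne']
  field_simp
  ring

/-- Nonnegativity and separation of the density power divergence on finitely supported
distributions: for `λ > 0` and probability vectors `p` (positive) and `q` (nonnegative),
`d_λ(q,p) = Σ_l [p_l^{λ+1} − ((λ+1)/λ) p_l^λ q_l + (1/λ) q_l^{λ+1}] ≥ 0`, with equality
iff `p = q`. -/
theorem dpd_nonneg_eq_iff (d : ℕ) (lam : ℝ) (hlam : 0 < lam)
    (p q : Fin (d + 1) → ℝ)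
    (hp : ∀ l, 0 < p l) (hq : ∀ l, 0 ≤ q l)
    (hps : ∑ l, p l = 1) (hqs : ∑ l, q l = 1) :
    0 ≤ ∑ l, (p l ^ (lam + 1) - ((lam + 1) / lam) * p l ^ lam * q l
        + (1 / lam) * q l ^ (lam + 1)) ∧
    ((∑ l, (p l ^ (lam + 1) - ((lam + 1) / lam) * p l ^ lam * q l
        + (1 / lam) * q l ^ (lam + 1))) = 0 ↔ p = q) := by
  have hnn : ∀ l ∈ Finset.univ, 0 ≤ p l ^ (lam + 1) - ((lam + 1) / lam) * p l ^ lam * q l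
        + (1 / lam) * q l ^ (lam + 1) := by
    intro l _
    by_cases h : p l = q l
    · rw [← h, dpd_term_self lam (p l) hlam (hp l)]
    · exact (dpd_term_pos lam (p l) (q l) hlam (hp l) (hq l) h).le
  refine ⟨Finset.sum_nonneg hnn, ?_, ?_⟩
  · intro h
    rw [Finset.sum_eq_zero_iff_of_nonneg hnn] at h
    funext l
    by_contra hne
    exact (dpd_term_pos lam (p l) (q l) hlam (hp l) (hq l) hne).ne' (h l (Finset.mem_univ l))
  · rintro rfl
    exact Finset.sum_eq_zero fun l _ => dpd_term_self lam (p l) hlam (hp l)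
end

section
/- Fix λ > 0, β₀ ∈ ℝ^{d(k+1)}, and data consisting, for each stratum h = 1,…,H and cluster i = 1,…,n_h, of a covariate x_hi ∈ ℝ^{k+1}, a weight w_hi > 0 and a size m_hi > 0. Define the total weighted DPD objective d_λ(β) = Σ_{h=1}^H Σ_{i=1}^{n_h} w_hi m_hi Σ_{l=1}^{d+1} [ π_hil(β)^{λ+1} − ((λ+1)/λ) π_hil(β₀) π_hil(β)^λ ], where π_hi(β) = π(β, x_hi). Then for every β ∈ ℝ^{d(k+1)}, d_λ(β) ≥ d_λ(β₀); that is, the true parameter β₀ is a global minimizer of the total weighted DPD between the model probabilities and the true PLR probabilities (Fisher consistency of the minimum quasi weighted DPD functional at the model). -/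
theorem plr_pos_aux (d k : ℕ) (β : Fin d → Fin (k + 1) → ℝ) (x : Fin (k + 1) → ℝ)
    (r : Fin (d + 1)) : 0 < plr d k β x r := by
  unfold plr
  have : 0 ≤ ∑ l, Real.exp (∑ u, x u * β l u) :=
    Finset.sum_nonneg fun _ _ => (Real.exp_pos _).le
  split_ifs <;> positivity

theorem dpd_term (lam p q : ℝ) (hlam : 0 < lam) (hp : 0 < p) (hq : 0 < q) :
    p ^ (lam + 1) - ((lam + 1) / lam) * p * p ^ lam ≤
      q ^ (lam + 1) - ((lam + 1) / lam) * p * q ^ lam := by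
  have hc : (lam + 1).HolderConjugate ((lam + 1) / lam) := by
    rw [Real.holderConjugate_iff]
    refine ⟨by linarith, ?_⟩
    field_simp
    try ring
  have hy := Real.young_inequality_of_nonneg hp.le (Real.rpow_nonneg hq.le lam) hc
  rw [← Real.rpow_mul hq.le, mul_div_cancel₀ _ hlam.ne'] at hy
  have h2 := mul_le_mul_of_nonneg_left hy (by positivity : 0 ≤ (lam + 1) / lam)
  have e1 : (lam + 1) / lam * (p ^ (lam + 1) / (lam + 1) +
      q ^ (lam + 1) / ((lam + 1) / lam)) = p ^ (lam + 1) / lam + q ^ (lam + 1) := by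
    field_simp
  have e2 : (lam + 1) / lam * p * p ^ lam = p ^ (lam + 1) + p ^ (lam + 1) / lam := by
    rw [Real.rpow_add hp, Real.rpow_one]
    field_simp
  rw [e1] at h2
  rw [e2]
  linarith

/-- Fisher consistency of the minimum quasi weighted DPD functional at the model: the
true parameter `β₀` globally minimizes the total weighted DPD objective
`d_λ(β) = Σ_{h,i} w_hi m_hi Σ_l [π_hil(β)^{λ+1} − ((λ+1)/λ) π_hil(β₀) π_hil(β)^λ]`. -/
theorem dpd_fisher_consistency (d k H : ℕ) (lam : ℝ) (hlam : 0 < lam)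
    (β₀ : Fin d → Fin (k + 1) → ℝ) (nh : Fin H → ℕ)
    (x : ∀ h : Fin H, Fin (nh h) → Fin (k + 1) → ℝ)
    (w m : ∀ h : Fin H, Fin (nh h) → ℝ)
    (hw : ∀ h i, 0 < w h i) (hm : ∀ h i, 0 < m h i) :
    ∀ β : Fin d → Fin (k + 1) → ℝ,
      (∑ h, ∑ i, w h i * m h i *
        ∑ l, (plr d k β₀ (x h i) l ^ (lam + 1)
          - ((lam + 1) / lam) * plr d k β₀ (x h i) l * plr d k β₀ (x h i) l ^ lam)) ≤
      (∑ h, ∑ i, w h i * m h i *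
        ∑ l, (plr d k β (x h i) l ^ (lam + 1)
          - ((lam + 1) / lam) * plr d k β₀ (x h i) l * plr d k β (x h i) l ^ lam)) := by
  intro β
  refine Finset.sum_le_sum fun h _ => Finset.sum_le_sum fun i _ =>
    mul_le_mul_of_nonneg_left (Finset.sum_le_sum fun l _ => ?_)
      (mul_pos (hw h i) (hm h i)).le
  exact dpd_term lam _ _ hlam (plr_pos_aux d k β₀ (x h i) l) (plr_pos_aux d k β (x h i) l)
end

section
/- Fix λ > 0, n ∈ ℕ with n ≥ 1, and data consisting, for each stratum h = 1,…,H and cluster i = 1,…,n_h (with n = Σ_h n_h), of a covariate x_hi ∈ ℝ^{k+1}, a weight w_hi ∈ ℝ, a size m_hi > 0, and a probability vector g_hi ∈ ℝ^{d+1}. Define the functional estimating equation u*_λ(g, β) = Σ_{h,i} u*_{λ,hi}(g_hi, β), where u*_{λ,hi}(v, β) = [ w_hi m_hi Δ*(π_hi(β)) diag^{λ−1}(π_hi(β)) (v − π_hi(β)) ] ⊗ x_hi and π_hi(β) = π(β, x_hi). Fix a contaminated cluster (h₀, i₀) and a point t ∈ ℝ^{d+1}, and for ε ∈ ℝ let g(ε)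 be the family with g_hi(ε) = g_hi for (h,i) ≠ (h₀,i₀) and g_{h₀i₀}(ε) = (1−ε) g_{h₀i₀} + ε t. Suppose β : ℝ → ℝ^{d(k+1)} is differentiable at 0 and satisfies u*_λ(g(ε), β(ε)) = 0 for all ε in a neighborhood of 0, that the map β ↦ u*_λ(g, β) is differentiable at β(0), and that the matrix Ψ*_n = −(1/n) · ∂u*_λ(g, β)/∂β evaluated at β(0) is invertible. Then the influence function β′(0) equals (1/n) Ψ*_n^{−1} [ u*_{λ,h₀i₀}(t, β(0)) − u*_{λ,h₀i₀}(g_{h₀i₀}, β(0)) ]. -/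
open Real Matrix

/-- PLR probabilities with the parameter indexed by pairs `(r,u) ∈ Fin d × Fin (k+1)`. -/
noncomputable def plr2 (d k : ℕ) (β : Fin d × Fin (k + 1) → ℝ) (x : Fin (k + 1) → ℝ) :
    Fin (d + 1) → ℝ := fun r =>
  if h : (r : ℕ) < d then
    Real.exp (∑ u, x u * β (⟨r, h⟩, u)) / (1 + ∑ l, Real.exp (∑ u, x u * β (l, u)))
  else 1 / (1 + ∑ l, Real.exp (∑ u, x u * β (l, u)))

/-- `u*_{λ,hi}(v,β) = [w m Δ*(π(β,x)) diag^{λ−1}(π(β,x)) (v − π(β,x))] ⊗ x`. -/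
noncomputable def uStarCell (lam : ℝ) (d k : ℕ) (w m : ℝ) (x : Fin (k + 1) → ℝ)
    (v : Fin (d + 1) → ℝ) (β : Fin d × Fin (k + 1) → ℝ) : Fin d × Fin (k + 1) → ℝ :=
  fun a => w * m * ((DeltaStar d (plr2 d k β x) * diagPow lam (plr2 d k β x)).mulVec
      (v - plr2 d k β x)) a.1 * x a.2

lemma plr2_pos (d k : ℕ) (x : Fin (k + 1) → ℝ) (β : Fin d × Fin (k + 1) → ℝ) (r : Fin (d + 1)) :
    0 < plr2 d k β x r := by
  unfold plr2
  have : 0 < 1 + ∑ l, Real.exp (∑ u, x u * β (l, u)) := by positivity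
  split_ifs <;> positivity

lemma plr2_cont (d k : ℕ) (x : Fin (k + 1) → ℝ) (r : Fin (d + 1)) :
    Continuous (fun β : Fin d × Fin (k + 1) → ℝ => plr2 d k β x r) := by
  unfold plr2
  have h0 : ∀ β : Fin d × Fin (k + 1) → ℝ,
      1 + ∑ l, Real.exp (∑ u, x u * β (l, u)) ≠ 0 := fun β => by positivity
  split_ifs
  · exact Continuous.div (by fun_prop) (by fun_prop) h0
  · exact Continuous.div (by fun_prop) (by fun_prop) h0

lemma uStarCell_cont (lam : ℝ) (d k : ℕ) (w m : ℝ) (x : Fin (k + 1) → ℝ)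
    (v : Fin (d + 1) → ℝ) (a : Fin d × Fin (k + 1)) :
    Continuous (fun β => uStarCell lam d k w m x v β a) := by
  have hp := plr2_cont d k x
  have hpow : ∀ l, Continuous (fun β : Fin d × Fin (k + 1) → ℝ => plr2 d k β x l ^ (lam - 1)) :=
    fun l => (hp l).rpow_const fun β => Or.inl (plr2_pos d k x β l).ne'
  unfold uStarCell diagPow DeltaStar DeltaMat
  simp only [Matrix.mulVec, dotProduct, Matrix.mul_diagonal, Matrix.of_apply, Matrix.sub_apply,
    Pi.sub_apply, Matrix.diagonal_apply]
  refine Continuous.mul (Continuous.mul continuous_const ?_) continuous_const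
  refine continuous_finset_sum _ fun j _ => ?_
  refine Continuous.mul (Continuous.mul (Continuous.sub ?_ ((hp _).mul (hp _))) (hpow j))
    (continuous_const.sub (hp j))
  split_ifs
  · exact hp _
  · exact continuous_const

lemma uStarCell_mix (lam : ℝ) (d k : ℕ) (w m : ℝ) (x : Fin (k + 1) → ℝ)
    (v t : Fin (d + 1) → ℝ) (ε : ℝ) (β : Fin d × Fin (k + 1) → ℝ) (a : Fin d × Fin (k + 1)) :
    uStarCell lam d k w m x ((1 - ε) • v + ε • t) β a = uStarCell lam d k w m x v β a +
      ε * (uStarCell lam d k w m x t β a - uStarCell lam d k w m x v β a) := by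
  unfold uStarCell
  simp only [Matrix.mulVec_sub, Matrix.mulVec_add, Matrix.mulVec_smul, Pi.sub_apply, Pi.add_apply,
    Pi.smul_apply, smul_eq_mul]
  ring

lemma hasDerivAt_id_mul (f : ℝ → ℝ) (hf : ContinuousAt f 0) :
    HasDerivAt (fun ε => ε * f ε) (f 0) 0 := by
  rw [hasDerivAt_iff_tendsto_slope]
  refine (hf.tendsto.mono_left nhdsWithin_le_nhds).congr' ?_
  filter_upwards [self_mem_nhdsWithin] with ε hε
  have : ε ≠ 0 := hε
  simp [slope_def_field]
  field_simp

/-- Influence function of the minimum quasi weighted DPD functional under contamination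
of a single cluster `(h₀,i₀)`: if `β(ε)` solves the contaminated estimating equations
`u*_λ(g(ε), β(ε)) = 0` near `ε = 0` and `Ψ*_n = −(1/n) ∂u*_λ(g,β)/∂β` at `β(0)` is
invertible, then `β′(0) = (1/n) Ψ*_n⁻¹ [u*_{λ,h₀i₀}(t,β(0)) − u*_{λ,h₀i₀}(g_{h₀i₀},β(0))]`. -/
theorem influence_function_mdpde (d k H : ℕ) (lam : ℝ) (hlam : 0 < lam)
    (nh : Fin H → ℕ)
    (x : ∀ h : Fin H, Fin (nh h) → Fin (k + 1) → ℝ)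
    (w m : ∀ h : Fin H, Fin (nh h) → ℝ)
    (g : ∀ h : Fin H, Fin (nh h) → Fin (d + 1) → ℝ)
    (h₀ : Fin H) (i₀ : Fin (nh h₀)) (t : Fin (d + 1) → ℝ)
    (βc : ℝ → Fin d × Fin (k + 1) → ℝ) (hβ : DifferentiableAt ℝ βc 0)
    -- the contaminated cluster probabilities: g_hi(ε) = g_hi except
    -- g_{h₀i₀}(ε) = (1−ε) g_{h₀i₀} + ε t
    (gmix : ℝ → ∀ h : Fin H, Fin (nh h) → Fin (d + 1) → ℝ)
    (hgmix : ∀ (ε : ℝ) (h : Fin H) (i : Fin (nh h)),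
      gmix ε h i = if (⟨h, i⟩ : Σ h : Fin H, Fin (nh h)) = ⟨h₀, i₀⟩ then
        (1 - ε) • g h i + ε • t else g h i)
    (hroot : ∀ᶠ ε in nhds (0 : ℝ), ∀ a : Fin d × Fin (k + 1),
      (∑ h, ∑ i, uStarCell lam d k (w h i) (m h i) (x h i) (gmix ε h i) (βc ε) a) = 0)
    (hdiff : ∀ a : Fin d × Fin (k + 1), DifferentiableAt ℝ
      (fun β : Fin d × Fin (k + 1) → ℝ =>
        ∑ h, ∑ i, uStarCell lam d k (w h i) (m h i) (x h i) (g h i) β a) (βc 0))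
    (PsiStar : Matrix (Fin d × Fin (k + 1)) (Fin d × Fin (k + 1)) ℝ)
    (hPsi : ∀ a b : Fin d × Fin (k + 1), PsiStar a b =
      -(((∑ h, nh h : ℕ) : ℝ))⁻¹ *
        fderiv ℝ (fun β : Fin d × Fin (k + 1) → ℝ =>
          ∑ h, ∑ i, uStarCell lam d k (w h i) (m h i) (x h i) (g h i) β a) (βc 0)
          (Pi.single b 1))
    (hinv : IsUnit PsiStar.det) :
    deriv βc 0 = fun a : Fin d × Fin (k + 1) =>
      (((∑ h, nh h : ℕ) : ℝ))⁻¹ *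
        (PsiStar⁻¹.mulVec fun b =>
          uStarCell lam d k (w h₀ i₀) (m h₀ i₀) (x h₀ i₀) t (βc 0) b -
          uStarCell lam d k (w h₀ i₀) (m h₀ i₀) (x h₀ i₀) (g h₀ i₀) (βc 0) b) a := by
  set n : ℝ := ((∑ h, nh h : ℕ) : ℝ) with hn
  set D : (Fin d × Fin (k + 1) → ℝ) → Fin d × Fin (k + 1) → ℝ := fun β b =>
    uStarCell lam d k (w h₀ i₀) (m h₀ i₀) (x h₀ i₀) t β b -
      uStarCell lam d k (w h₀ i₀) (m h₀ i₀) (x h₀ i₀) (g h₀ i₀) β b with hD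
  have hsum : ∀ ε β a,
      (∑ h, ∑ i, uStarCell lam d k (w h i) (m h i) (x h i) (gmix ε h i) β a) =
      (∑ h, ∑ i, uStarCell lam d k (w h i) (m h i) (x h i) (g h i) β a) + ε * D β a := by
    intro ε β a
    have key : ∀ p : (Σ h : Fin H, Fin (nh h)),
        uStarCell lam d k (w p.1 p.2) (m p.1 p.2) (x p.1 p.2) (gmix ε p.1 p.2) β a =
        uStarCell lam d k (w p.1 p.2) (m p.1 p.2) (x p.1 p.2) (g p.1 p.2) β a +
          if p = ⟨h₀, i₀⟩ then ε * D β a else 0 := by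
      rintro ⟨h, i⟩
      rw [hgmix]
      by_cases hc : (⟨h, i⟩ : Σ h : Fin H, Fin (nh h)) = ⟨h₀, i₀⟩
      · rw [if_pos hc, if_pos hc]
        cases hc
        exact uStarCell_mix ..
      · rw [if_neg hc, if_neg hc, add_zero]
    have h1 := Finset.sum_congr (rfl : (Finset.univ : Finset (Σ h : Fin H, Fin (nh h))) = _)
      (fun p _ => key p)
    rw [Finset.sum_add_distrib, Finset.sum_ite_eq' Finset.univ, if_pos (Finset.mem_univ _),
      Fintype.sum_sigma, Fintype.sum_sigma] at h1
    exact h1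
  have hlin : ∀ a, fderiv ℝ (fun β : Fin d × Fin (k + 1) → ℝ =>
      ∑ h, ∑ i, uStarCell lam d k (w h i) (m h i) (x h i) (g h i) β a) (βc 0) (deriv βc 0)
        + D (βc 0) a = 0 := by
    intro a
    have h1 := (hdiff a).hasFDerivAt.comp_hasDerivAt (0 : ℝ) hβ.hasDerivAt
    have hc : ContinuousAt (fun ε => D (βc ε) a) 0 := by
      have : Continuous (fun β => D β a) :=
        (uStarCell_cont ..).sub (uStarCell_cont ..)
      exact this.continuousAt.comp hβ.continuousAt
    have h2 := h1.add (hasDerivAt_id_mul _ hc)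
    refine h2.unique ((hasDerivAt_const (0 : ℝ) (0 : ℝ)).congr_of_eventuallyEq ?_)
    filter_upwards [hroot] with ε hε
    have := hε a
    rw [hsum] at this
    exact this
  have hmv : PsiStar.mulVec (deriv βc 0) = n⁻¹ • D (βc 0) := by
    funext a
    have h3 := hlin a
    rw [← eq_neg_iff_add_eq_zero, ← neg_eq_iff_eq_neg] at h3
    rw [Pi.smul_apply, smul_eq_mul, ← h3]
    conv_rhs => rw [pi_eq_sum_univ' (deriv βc 0)]
    simp only [Matrix.mulVec, dotProduct, hPsi, map_sum, map_smul, smul_eq_mul]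
    rw [← Finset.sum_neg_distrib, Finset.mul_sum]
    refine Finset.sum_congr rfl fun b _ => ?_
    have : (Pi.single b 1 : Fin d × Fin (k + 1) → ℝ) = fun j => if b = j then 1 else 0 := by
      funext j
      simp [Pi.single_apply, eq_comm]
    first
      | ring
      | (rw [this]; ring)
  have hfin : deriv βc 0 = PsiStar⁻¹.mulVec (n⁻¹ • D (βc 0)) := by
    rw [← hmv, Matrix.mulVec_mulVec, Matrix.nonsing_inv_mul _ hinv, Matrix.one_mulVec]
  rw [hfin, Matrix.mulVec_smul]
  rfl
end
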